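/- arXiv:2405.09615 — 10 statements merged into one kernel-verified Lean document; each statement's English description precedes it below -/
import Mathlib

section
/- Let d, D ≥ 1, let A : Matrix (Fin d) (Fin D × Fin D) ℂ, and let (P_i)_{i∈ι} and (P'_i)_{i∈ι} be families of unitary D×D complex matrices such that the family (P_i)_{i∈ι} spans Matrix (Fin D) (Fin D) ℂ as a ℂ-vector space. Assume that A has the MF symmetry with respect to (P_i, P'_i), i.e. for every i ∈ ι there exists a unitary u ∈ Matrix (Fin d) (Fin d) ℂ with u * A = A * (conj(P_i) ⊗ₖ P'_i). Then there exists a real number c ≥ 0 such that the D×D matrix N defined by N a a' = Σ_{k : Fin d} Σ_{b : Fin D} conj(A k (a, b)) * A k (a', b) (the partial trace of AᴴA over the second virtual factor) equals c • 1. In other words, the MPS tensor A is automatically in canonical form: regarded as a linear map from the right virtual space ℂ^D to ℂ^d ⊗ ℂ^D it is a nonnegative multiple of an isometry. -/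
open Matrix Kronecker

def mfS {d D : ℕ} (A : Matrix (Fin d) (Fin D × Fin D) ℂ) : Matrix (Fin D) (Fin D) ℂ :=
  ∑ k, (Matrix.of fun a b => A k (a, b)) * (Matrix.of fun a b => A k (a, b))ᴴ

theorem mfS_apply {d D : ℕ} (A : Matrix (Fin d) (Fin D × Fin D) ℂ) (a a' : Fin D) :
    mfS A a a' = ∑ b, (Aᴴ * A) (a', b) (a, b) := by
  simp only [mfS, Matrix.sum_apply, Matrix.mul_apply, Matrix.conjTranspose_apply, Matrix.of_apply]
  rw [Finset.sum_comm]
  simp only [mul_comm]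

theorem mfS_unitary {d D : ℕ} (A : Matrix (Fin d) (Fin D × Fin D) ℂ) (u : Matrix (Fin d) (Fin d) ℂ)
    (hu : u ∈ Matrix.unitaryGroup (Fin d) ℂ) : mfS (u * A) = mfS A := by
  have h : (u * A)ᴴ * (u * A) = Aᴴ * A := by
    rw [Matrix.conjTranspose_mul, Matrix.mul_assoc, ← Matrix.mul_assoc uᴴ u A,
      ← Matrix.star_eq_conjTranspose u, Matrix.mem_unitaryGroup_iff'.1 hu, Matrix.one_mul]
  ext a a'
  rw [mfS_apply, mfS_apply, h]

theorem mfS_kron {d D : ℕ} (A : Matrix (Fin d) (Fin D × Fin D) ℂ) (P R : Matrix (Fin D) (Fin D) ℂ)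
    (hR : R ∈ Matrix.unitaryGroup (Fin D) ℂ) :
    mfS (A * (P.map (starRingEnd ℂ) ⊗ₖ R)) = Pᴴ * mfS A * P := by
  have hR' : R * Rᴴ = 1 := Matrix.mem_unitaryGroup_iff.1 hR
  have h : ∀ k, (Matrix.of fun a b => (A * (P.map (starRingEnd ℂ) ⊗ₖ R)) k (a, b))
      = Pᴴ * (Matrix.of fun a b => A k (a, b)) * R := by
    intro k
    ext a b
    simp only [Matrix.of_apply, Matrix.mul_apply, Fintype.sum_prod_type, Matrix.kronecker_apply,
      Matrix.map_apply, Matrix.conjTranspose_apply, Finset.sum_mul]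
    rw [Finset.sum_comm]
    refine Finset.sum_congr rfl fun x _ => Finset.sum_congr rfl fun y _ => ?_
    rw [starRingEnd_apply]
    ring
  unfold mfS
  rw [Finset.mul_sum, Finset.sum_mul]
  refine Finset.sum_congr rfl fun k _ => ?_
  rw [h k]
  simp only [Matrix.conjTranspose_mul, Matrix.conjTranspose_conjTranspose, Matrix.mul_assoc]
  rw [← Matrix.mul_assoc R Rᴴ, hR', Matrix.one_mul]

/-- **MF MPS are in canonical form.**
If an MPS tensor `A` has the MF symmetry with respect to families of unitaries
`(P i)` and `(P' i)` such that `(P i)` spans all `D × D` matrices, then the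
partial trace of `Aᴴ * A` over the second virtual factor is a nonnegative
multiple of the identity, i.e. `A` viewed as a map `ℂ^D → ℂ^d ⊗ ℂ^D` is a
nonnegative multiple of an isometry. -/
theorem mf_mps_canonical_form (d D : ℕ) (hd : 1 ≤ d) (hD : 1 ≤ D)
    (A : Matrix (Fin d) (Fin D × Fin D) ℂ)
    (ι : Type*) (P P' : ι → Matrix (Fin D) (Fin D) ℂ)
    (hPU : ∀ i, P i ∈ Matrix.unitaryGroup (Fin D) ℂ)
    (hP'U : ∀ i, P' i ∈ Matrix.unitaryGroup (Fin D) ℂ)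
    (hspan : Submodule.span ℂ (Set.range P) = ⊤)
    (hsym : ∀ i, ∃ u ∈ Matrix.unitaryGroup (Fin d) ℂ,
      u * A = A * ((P i).map (starRingEnd ℂ) ⊗ₖ P' i)) :
    ∃ c : ℝ, 0 ≤ c ∧
      (Matrix.of fun a a' : Fin D =>
          ∑ k : Fin d, ∑ b : Fin D, (starRingEnd ℂ) (A k (a, b)) * A k (a', b))
        = (c : ℂ) • (1 : Matrix (Fin D) (Fin D) ℂ) := by
  have hc : ∀ X : Matrix (Fin D) (Fin D) ℂ, X * mfS A = mfS A * X := by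
    intro X
    have hX : X ∈ Submodule.span ℂ (Set.range P) := by rw [hspan]; trivial
    induction hX using Submodule.span_induction with
    | mem x hx =>
      obtain ⟨i, rfl⟩ := hx
      obtain ⟨u, hu, h⟩ := hsym i
      have h1 : mfS A = (P i)ᴴ * mfS A * P i := by
        rw [← mfS_kron A (P i) (P' i) (hP'U i), ← h, mfS_unitary A u hu]
      have h2 : P i * (P i)ᴴ = 1 := Matrix.mem_unitaryGroup_iff.1 (hPU i)
      calc P i * mfS A = P i * ((P i)ᴴ * mfS A * P i) := by rw [← h1]
        _ = (P i * (P i)ᴴ) * mfS A * P i := by simp only [Matrix.mul_assoc]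
        _ = mfS A * P i := by rw [h2, Matrix.one_mul]
    | zero => simp
    | add x y _ _ hx hy => rw [add_mul, mul_add, hx, hy]
    | smul a x _ hx => rw [Matrix.smul_mul, Matrix.mul_smul, hx]
  have hN : (Matrix.of fun a a' : Fin D =>
      ∑ k : Fin d, ∑ b : Fin D, (starRingEnd ℂ) (A k (a, b)) * A k (a', b)) = (mfS A)ᵀ := by
    ext a a'
    rw [Matrix.transpose_apply, mfS_apply, Matrix.of_apply, Finset.sum_comm]
    simp [Matrix.mul_apply]
  obtain ⟨z, hz⟩ : mfS A ∈ Set.range (Matrix.scalar (Fin D)) := by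
    refine Matrix.mem_range_scalar_of_commute_single fun i j _ => hc _
  let o : Fin D := ⟨0, hD⟩
  have hzo : z = ((∑ k : Fin d, ∑ b : Fin D, Complex.normSq (A k (o, b)) : ℝ) : ℂ) := by
    have h1 := congrFun (congrFun hN o) o
    rw [← hz] at h1
    simp only [Matrix.of_apply, Matrix.transpose_apply, Matrix.scalar_apply,
      Matrix.diagonal_apply_eq] at h1
    rw [← h1]
    push_cast
    simp only [Complex.normSq_eq_conj_mul_self]
  refine ⟨∑ k : Fin d, ∑ b : Fin D, Complex.normSq (A k (o, b)),
    Finset.sum_nonneg fun k _ => Finset.sum_nonneg fun b _ => Complex.normSq_nonneg _, ?_⟩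
  rw [hN, ← hz, ← hzo, Matrix.scalar_apply, Matrix.diagonal_transpose, Matrix.smul_one_eq_diagonal]
end

section
/- Let d, D ≥ 1, let A : Matrix (Fin d) (Fin D × Fin D) ℂ, and let (P_i)_{i∈ι} and (P'_i)_{i∈ι} be families of unitary D×D complex matrices. Assume that A has the MF symmetry: for every i ∈ ι there exists a unitary u ∈ Matrix (Fin d) (Fin d) ℂ with u * A = A * (conj(P_i) ⊗ₖ P'_i). Let Q be the (unique) positive semidefinite square root of the positive semidefinite matrix Aᴴ * A ∈ Matrix (Fin D × Fin D) (Fin D × Fin D) ℂ. Then Q commutes with the unitary conj(P_i) ⊗ₖ P'_i for every i ∈ ι, i.e. Q * (conj(P_i) ⊗ₖ P'_i) = (conj(P_i) ⊗ₖ P'_i) * Q. -/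
open Matrix Kronecker ComplexOrder

theorem psd_sqrt_unique_aux {n : Type*} [Fintype n] [DecidableEq n] {Q R : Matrix n n ℂ}
    (hQ : Q.PosSemidef) (hR : R.PosSemidef) (h : Q * Q = R * R) : Q = R := by
  open scoped MatrixOrder Matrix.Norms.L2Operator in
  exact (CFC.sqrt_unique (a := R * R) h hQ.nonneg).symm.trans
    (CFC.sqrt_unique (a := R * R) rfl hR.nonneg)

/-- **The positive square root of `Aᴴ A` inherits the MF symmetry.**
If an MPS tensor `A` has the MF symmetry with respect to families of unitaries
`(P i)` and `(P' i)`, and `Q` is the (unique) positive semidefinite square root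
of `Aᴴ * A`, then `Q` commutes with `conj (P i) ⊗ₖ P' i` for every `i`. -/
theorem mf_mps_sqrt_commutes (d D : ℕ) (hd : 1 ≤ d) (hD : 1 ≤ D)
    (A : Matrix (Fin d) (Fin D × Fin D) ℂ)
    (ι : Type*) (P P' : ι → Matrix (Fin D) (Fin D) ℂ)
    (hPU : ∀ i, P i ∈ Matrix.unitaryGroup (Fin D) ℂ)
    (hP'U : ∀ i, P' i ∈ Matrix.unitaryGroup (Fin D) ℂ)
    (hsym : ∀ i, ∃ u ∈ Matrix.unitaryGroup (Fin d) ℂ,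
      u * A = A * ((P i).map (starRingEnd ℂ) ⊗ₖ P' i))
    (Q : Matrix (Fin D × Fin D) (Fin D × Fin D) ℂ)
    (hQpsd : Q.PosSemidef) (hQsq : Q * Q = Aᴴ * A) :
    ∀ i, Q * ((P i).map (starRingEnd ℂ) ⊗ₖ P' i)
        = ((P i).map (starRingEnd ℂ) ⊗ₖ P' i) * Q := by
  intro i
  obtain ⟨u, hu, h⟩ := hsym i
  have hW : (P i).map (starRingEnd ℂ) ⊗ₖ P' i ∈ Matrix.unitaryGroup (Fin D × Fin D) ℂ := by
    refine Matrix.kronecker_mem_unitary ?_ (hP'U i)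
    have h1 := Matrix.mem_unitaryGroup_iff.1 (hPU i)
    rw [Matrix.mem_unitaryGroup_iff]
    have h2 := congrArg (fun M => M.map (starRingEnd ℂ)) h1
    simp only [Matrix.map_mul] at h2
    rw [Matrix.map_one _ (map_zero _) (map_one _)] at h2
    exact h2
  generalize (P i).map (starRingEnd ℂ) ⊗ₖ P' i = W at h hW ⊢
  have hW1 : W * Wᴴ = 1 := Matrix.mem_unitaryGroup_iff.1 hW
  have hu1 : uᴴ * u = 1 := Matrix.mem_unitaryGroup_iff'.1 hu
  have hS : Wᴴ * (Q * Q) * W = Q * Q := by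
    calc Wᴴ * (Q * Q) * W = (A * W)ᴴ * (A * W) := by
          rw [hQsq, Matrix.conjTranspose_mul]; simp only [Matrix.mul_assoc]
      _ = Aᴴ * ((uᴴ * u) * A) := by
          rw [← h, Matrix.conjTranspose_mul]; simp only [Matrix.mul_assoc]
      _ = Q * Q := by rw [hu1, Matrix.one_mul, hQsq]
  have hR : Q = Wᴴ * Q * W := by
    refine psd_sqrt_unique_aux hQpsd (hQpsd.conjTranspose_mul_mul_same W) ?_
    calc Q * Q = Wᴴ * (Q * (1 * Q)) * W := by rw [Matrix.one_mul, hS]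
      _ = _ := by rw [← hW1]; simp only [Matrix.mul_assoc]
  calc Q * W = (W * Wᴴ) * Q * W := by rw [hW1, Matrix.one_mul]
    _ = W * (Wᴴ * Q * W) := by simp only [Matrix.mul_assoc]
    _ = W * Q := by rw [← hR]
end

section
/- Let d, D ≥ 1, let A : Matrix (Fin d) (Fin D × Fin D) ℂ, let (P_i)_{i∈ι} and (P'_i)_{i∈ι} be families of unitary D×D matrices, and for each i let u_i ∈ Matrix (Fin d) (Fin d) ℂ be a fixed unitary with u_i * A = A * (conj(P_i) ⊗ₖ P'_i). Let Q be the positive semidefinite square root of Aᴴ * A, let R ∈ Matrix (Fin D × Fin D) (Fin D × Fin D) ℂ be the orthogonal projection onto the range of Q (i.e. R = Rᴴ, R * R = R, and the column space of R equals the column space of Q), and let V : Matrix (Fin d) (Fin D × Fin D) ℂ be any matrix satisfying A = V * Q, Vᴴ * V = R and V * R = V (a polar decomposition of A). Then for every i ∈ ι: Vᴴ * u_i * V = (conj(P_i) ⊗ₖ P'_i) * R. In particular, the physical correction unitary u_i agrees, after conjugation by the isometry V, with the virtual operator conj(P_i) ⊗ₖ P'_i on the range of Q. -/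
open Matrix Kronecker ComplexOrder

theorem exists_mul_of_range_le {n : Type*} [Fintype n] [DecidableEq n] (R Q : Matrix n n ℂ)
    (h : LinearMap.range R.mulVecLin ≤ LinearMap.range Q.mulVecLin) :
    ∃ X : Matrix n n ℂ, R = Q * X := by
  have h1 : ∀ j, ∃ x : n → ℂ, Q *ᵥ x = R *ᵥ (Pi.single j 1) := fun j =>
    h (LinearMap.mem_range_self R.mulVecLin (Pi.single j 1))
  choose x hx using h1
  refine ⟨Matrix.of fun a b => x b a, ?_⟩
  ext a b
  have := congrFun (hx b) a
  rw [Matrix.mulVec_single_one] at this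
  exact this.symm

/-- **The physical correction unitary agrees with the virtual operator on the
range of `Q`.**  Given a polar decomposition `A = V * Q` of an MPS tensor with
MF symmetry `u i * A = A * (conj (P i) ⊗ₖ P' i)`, where `Q` is the positive
semidefinite square root of `Aᴴ * A` and `R` is the orthogonal projection onto
the range of `Q`, we have `Vᴴ * u i * V = (conj (P i) ⊗ₖ P' i) * R`. -/
theorem mf_mps_correction_agrees (d D : ℕ) (hd : 1 ≤ d) (hD : 1 ≤ D)
    (ι : Type*)
    (A : Matrix (Fin d) (Fin D × Fin D) ℂ)
    (P P' : ι → Matrix (Fin D) (Fin D) ℂ)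
    (hPU : ∀ i, P i ∈ Matrix.unitaryGroup (Fin D) ℂ)
    (hP'U : ∀ i, P' i ∈ Matrix.unitaryGroup (Fin D) ℂ)
    (u : ι → Matrix (Fin d) (Fin d) ℂ)
    (hu : ∀ i, u i ∈ Matrix.unitaryGroup (Fin d) ℂ)
    (hsym : ∀ i, u i * A = A * ((P i).map (starRingEnd ℂ) ⊗ₖ P' i))
    (Q : Matrix (Fin D × Fin D) (Fin D × Fin D) ℂ)
    (hQpsd : Q.PosSemidef) (hQsq : Q * Q = Aᴴ * A)
    (R : Matrix (Fin D × Fin D) (Fin D × Fin D) ℂ)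
    (hRherm : R = Rᴴ) (hRproj : R * R = R)
    (hRrange : LinearMap.range R.mulVecLin = LinearMap.range Q.mulVecLin)
    (V : Matrix (Fin d) (Fin D × Fin D) ℂ)
    (hVQ : A = V * Q) (hVV : Vᴴ * V = R) (hVR : V * R = V) :
    ∀ i, Vᴴ * u i * V = ((P i).map (starRingEnd ℂ) ⊗ₖ P' i) * R := by
  intro i
  have hW1 : (P i).map (starRingEnd ℂ) ∈ Matrix.unitaryGroup (Fin D) ℂ := by
    have h := hPU i
    rw [Matrix.mem_unitaryGroup_iff, Matrix.star_eq_conjTranspose] at h ⊢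
    have h2 := congrArg (fun M : Matrix (Fin D) (Fin D) ℂ => M.map (starRingEnd ℂ)) h
    simp only [Matrix.map_mul] at h2
    rw [Matrix.map_one _ (map_zero _) (map_one _)] at h2
    rw [← h2]
    rfl
  have hW := Matrix.kronecker_mem_unitary hW1 (hP'U i)
  have hs := hsym i
  generalize (P i).map (starRingEnd ℂ) ⊗ₖ P' i = W at hW hs ⊢
  have hWW : W * Wᴴ = 1 := Matrix.mem_unitaryGroup_iff.mp hW
  have hWW' : Wᴴ * W = 1 := Matrix.mem_unitaryGroup_iff'.mp hW
  have huu : (u i)ᴴ * u i = 1 := Matrix.mem_unitaryGroup_iff'.mp (hu i)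
  have hcomm : Wᴴ * (Q * Q) * W = Q * Q := by
    rw [hQsq]
    calc Wᴴ * (Aᴴ * A) * W = (A * W)ᴴ * (A * W) := by
          simp only [Matrix.conjTranspose_mul, Matrix.mul_assoc]
      _ = Aᴴ * ((u i)ᴴ * u i) * A := by
          rw [← hs]; simp only [Matrix.conjTranspose_mul, Matrix.mul_assoc]
      _ = Aᴴ * A := by rw [huu, Matrix.mul_one]
  have hpsd2 : (Wᴴ * Q * W).PosSemidef := hQpsd.conjTranspose_mul_mul_same W
  have hsq2 : (Wᴴ * Q * W) * (Wᴴ * Q * W) = Q * Q := by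
    calc (Wᴴ * Q * W) * (Wᴴ * Q * W) = Wᴴ * Q * (W * Wᴴ) * Q * W := by
          simp only [Matrix.mul_assoc]
      _ = Q * Q := by rw [hWW, Matrix.mul_one, Matrix.mul_assoc Wᴴ, hcomm]
  have hQ2 : Wᴴ * Q * W = Q := by
    open scoped MatrixOrder Matrix.Norms.L2Operator in
    have h1 := CFC.sqrt_unique hsq2 hpsd2.nonneg
    have h2 := CFC.sqrt_unique (rfl : Q * Q = Q * Q) hQpsd.nonneg
    exact h1.symm.trans h2
  have hQW : Q * W = W * Q := by
    calc Q * W = (W * Wᴴ) * Q * W := by rw [hWW, Matrix.one_mul]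
      _ = W * (Wᴴ * Q * W) := by simp only [Matrix.mul_assoc]
      _ = W * Q := by rw [hQ2]
  obtain ⟨X, hX⟩ := exists_mul_of_range_le R Q hRrange.le
  obtain ⟨Y, hY⟩ := exists_mul_of_range_le Q R hRrange.ge
  have hRQ : R * Q = Q := by
    rw [hY, ← Matrix.mul_assoc, hRproj]
  have key : Vᴴ * u i * V * Q = W * Q := by
    calc Vᴴ * u i * V * Q = Vᴴ * (u i * A) := by
          rw [hVQ]; simp only [Matrix.mul_assoc]
      _ = (Vᴴ * V) * Q * W := by
          rw [hs, hVQ]; simp only [Matrix.mul_assoc]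
      _ = W * Q := by rw [hVV, hRQ, hQW]
  calc Vᴴ * u i * V = Vᴴ * u i * V * R := by rw [Matrix.mul_assoc _ V R, hVR]
    _ = Vᴴ * u i * V * Q * X := by rw [hX, ← Matrix.mul_assoc]
    _ = W * R := by rw [key, hX, Matrix.mul_assoc]
end

section
/- Let d, D ≥ 1, let ι be a finite index set, let (P_i)_{i∈ι} be a family of unitary D×D complex matrices, let σ : ι → ι be a bijection, and let A : Matrix (Fin d) (Fin D × Fin D) ℂ satisfy the MF symmetry with P'_i := P_{σ(i)}: for every i ∈ ι there exists a unitary u ∈ Matrix (Fin d) (Fin d) ℂ with u * A = A * (conj(P_i) ⊗ₖ P_{σ(i)}). For n ≥ 1 define the n-fold blocked tensor A⁽ⁿ⁾ : Matrix (Fin n → Fin d) (Fin D × Fin D) ℂ by A⁽ⁿ⁾ k (a, b) = Σ_{c₁, …, c_{n−1} : Fin D} A (k 0) (a, c₁) * A (k 1) (c₁, c₂) * ⋯ * A (k (n−1)) (c_{n−1}, b). Then there exists n ≥ 1 (any n with σⁿ = id works) such that A⁽ⁿ⁾ satisfies the SPT-type MF symmetry in which the left and right virtual operators coincide: for every i ∈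 ι there exists a unitary ũ ∈ Matrix (Fin n → Fin d) (Fin n → Fin d) ℂ with ũ * A⁽ⁿ⁾ = A⁽ⁿ⁾ * (conj(P_i) ⊗ₖ P_i). -/
open Matrix Kronecker

/-- The `n`-fold blocked MPS tensor:
`A⁽ⁿ⁾ k (a, b) = Σ_{c₁,…,c_{n−1}} A (k 0) (a, c₁) * ⋯ * A (k (n−1)) (c_{n−1}, b)`,
realized as the `(a,b)` entry of the ordered product of the physical slices. -/
noncomputable def blockedMPS (d D n : ℕ) (A : Matrix (Fin d) (Fin D × Fin D) ℂ) :
    Matrix (Fin n → Fin d) (Fin D × Fin D) ℂ :=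
  Matrix.of fun k ab =>
    (((List.finRange n).map fun i => Matrix.of fun a b : Fin D => A (k i) (a, b)).prod)
      ab.1 ab.2

theorem blocked_aux (d D : ℕ) (S : Fin d → Matrix (Fin D) (Fin D) ℂ) (n : ℕ) :
    ∀ (u : ℕ → Matrix (Fin d) (Fin d) ℂ) (Q : ℕ → Matrix (Fin D) (Fin D) ℂ)
    (_ : ∀ j, Q j ∈ Matrix.unitaryGroup (Fin D) ℂ)
    (_ : ∀ j k, ∑ l, u j k l • S l = (Q j)ᴴ * S k * Q (j+1))
    (k : Fin n → Fin d),
    ∑ l : Fin n → Fin d, (∏ j : Fin n, u j (k j) (l j)) •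
      ((List.finRange n).map fun j => S (l j)).prod
      = (Q 0)ᴴ * ((List.finRange n).map fun j => S (k j)).prod * Q n := by
  induction n with
  | zero =>
    intro u Q hQ h k
    have := (Matrix.mem_unitaryGroup_iff').1 (hQ 0)
    rw [Matrix.star_eq_conjTranspose] at this
    simp [this]
  | succ n ih =>
    intro u Q hQ h k
    have ih' := ih (fun j => u (j+1)) (fun j => Q (j+1)) (fun j => hQ _)
      (fun j k => h (j+1) k) (fun j => k j.succ)
    rw [← (Fin.consEquiv (fun _ : Fin (n+1) => Fin d)).sum_comp, Fintype.sum_prod_type]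
    simp only [Fin.consEquiv_apply, Fin.prod_univ_succ, Fin.cons_zero, Fin.cons_succ,
      List.finRange_succ, List.map_cons, List.prod_cons, List.map_map, Function.comp_def]
    have e : ∀ x : Fin d, ∀ y : Fin n → Fin d,
        (u ((0 : Fin (n+1)) : ℕ) (k 0) x * ∏ j : Fin n, u ((j.succ : Fin (n+1)) : ℕ) (k j.succ) (y j)) •
          (S x * ((List.finRange n).map fun j => S (y j)).prod)
        = (u 0 (k 0) x • S x) * ((∏ j : Fin n, u (j+1) (k j.succ) (y j)) •
          ((List.finRange n).map fun j => S (y j)).prod) := by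
      intro x y
      rw [smul_mul_smul_comm]
      simp
    simp only [e]
    simp only [← Finset.mul_sum, ← Finset.sum_mul]
    rw [h 0 (k 0), ih']
    have := (Matrix.mem_unitaryGroup_iff).1 (hQ 1)
    rw [Matrix.star_eq_conjTranspose] at this
    simp only [zero_add, Matrix.mul_assoc]
    rw [← Matrix.mul_assoc (Q 1) (Q 1)ᴴ, this, Matrix.one_mul]

theorem blocked_kron_unitary (d n : ℕ) (u : Fin n → Matrix (Fin d) (Fin d) ℂ)
    (hu : ∀ j, u j ∈ Matrix.unitaryGroup (Fin d) ℂ) :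
    (Matrix.of fun k l : Fin n → Fin d => ∏ j, u j (k j) (l j))
      ∈ Matrix.unitaryGroup (Fin n → Fin d) ℂ := by
  rw [Matrix.mem_unitaryGroup_iff]
  ext k m
  simp only [Matrix.mul_apply, Matrix.star_apply, Matrix.of_apply, star_prod,
    ← Finset.prod_mul_distrib]
  have h1 : ∀ j, ∑ x, u j (k j) x * star (u j (m j) x) = if k j = m j then 1 else 0 := by
    intro j
    have := congrFun (congrFun ((Matrix.mem_unitaryGroup_iff).1 (hu j)) (k j)) (m j)
    simpa [Matrix.mul_apply, Matrix.one_apply] using this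
  rw [← Fintype.prod_sum (fun j x => u j (k j) x * star (u j (m j) x))]
  simp only [h1, Matrix.one_apply, Finset.prod_ite_zero, funext_iff]
  simp

theorem blocked_kron_mul {κ : Type*} [Fintype κ] (D : ℕ) (A : Matrix κ (Fin D × Fin D) ℂ)
    (P Q : Matrix (Fin D) (Fin D) ℂ) (k : κ) (a b : Fin D) :
    (A * (P.map (starRingEnd ℂ) ⊗ₖ Q)) k (a, b)
      = (Pᴴ * (Matrix.of fun a b : Fin D => A k (a, b)) * Q) a b := by
  simp only [Matrix.mul_apply, Fintype.sum_prod_type, Matrix.kroneckerMap_apply,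
    Matrix.map_apply, Matrix.conjTranspose_apply, Matrix.of_apply, Finset.sum_mul]
  rw [Finset.sum_comm]
  refine Finset.sum_congr rfl fun y _ => Finset.sum_congr rfl fun x _ => ?_
  simp only [starRingEnd_apply]
  ring

/-- **Blocking recovers the SPT-type symmetry.**
If an MPS tensor `A` has the MF symmetry with right virtual operators given by a
bijection `σ` of the index set (`u i * A = A * (conj (P i) ⊗ₖ P (σ i))`),
then some finite blocking `A⁽ⁿ⁾` (`n ≥ 1`) has the SPT-type MF symmetry in
which the left and right virtual operators coincide. -/
theorem blocked_spt_symmetry (d D : ℕ) (hd : 1 ≤ d) (hD : 1 ≤ D)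
    (ι : Type*) [Fintype ι]
    (P : ι → Matrix (Fin D) (Fin D) ℂ)
    (hPU : ∀ i, P i ∈ Matrix.unitaryGroup (Fin D) ℂ)
    (σ : ι ≃ ι)
    (A : Matrix (Fin d) (Fin D × Fin D) ℂ)
    (hsym : ∀ i, ∃ u ∈ Matrix.unitaryGroup (Fin d) ℂ,
      u * A = A * ((P i).map (starRingEnd ℂ) ⊗ₖ P (σ i))) :
    ∃ n, 1 ≤ n ∧ ∀ i, ∃ u ∈ Matrix.unitaryGroup (Fin n → Fin d) ℂ,
      u * blockedMPS d D n A
        = blockedMPS d D n A * ((P i).map (starRingEnd ℂ) ⊗ₖ P i) := by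
  choose u hu hA using hsym
  obtain ⟨n, hn, hσ⟩ : ∃ n, 1 ≤ n ∧ (σ : Equiv.Perm ι) ^ n = 1 :=
    ⟨orderOf (σ : Equiv.Perm ι), orderOf_pos _, pow_orderOf_eq_one _⟩
  refine ⟨n, hn, fun i => ?_⟩
  let τ : Equiv.Perm ι := σ
  refine ⟨_, blocked_kron_unitary d n (fun j => u ((τ ^ (j : ℕ)) i)) (fun j => hu _), ?_⟩
  have key := blocked_aux d D (fun l => Matrix.of fun a b : Fin D => A l (a, b)) n
    (fun j => u ((τ ^ j) i)) (fun j => P ((τ ^ j) i)) (fun j => hPU _) (by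
      intro j k
      ext a b
      have := congrFun (congrFun (hA ((τ ^ j) i)) k) (a, b)
      rw [blocked_kron_mul] at this
      have e : (τ ^ (j+1)) i = σ ((τ ^ j) i) := by rw [pow_succ']; rfl
      rw [e, ← this]
      simp [Matrix.mul_apply, Matrix.sum_apply])
  have hτ : (τ ^ n) i = i := by
    have : τ ^ n = 1 := hσ
    rw [this]; rfl
  ext k ⟨a, b⟩
  rw [blocked_kron_mul]
  have h2 := congrFun (congrFun (key k) a) b
  simp only [hτ] at h2
  have e2 : (Matrix.of fun a b : Fin D => blockedMPS d D n A k (a, b))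
      = ((List.finRange n).map fun j => Matrix.of fun a b : Fin D => A (k j) (a, b)).prod := by
    ext a b; rfl
  rw [e2]
  refine Eq.trans ?_ h2
  simp only [Matrix.mul_apply, Matrix.sum_apply, Matrix.smul_apply, smul_eq_mul, Matrix.of_apply]
  rfl
end

section
/- Let d, D ≥ 1 and let A : Matrix (Fin d) (Fin D × Fin D × Fin D × Fin D) ℂ be a PEPS tensor with virtual indices ordered (left, top, right, bottom). Let (P_i, P_{i,1}, P_{i,2})_{i∈ι_A} and (P̃_j, P̃_{j,1}, P̃_{j,2})_{j∈ι_B} be families of unitary D×D matrices such that (P_i)_{i∈ι_A} spans Matrix (Fin D) (Fin D) ℂ and (P̃_j)_{j∈ι_B} spans Matrix (Fin D) (Fin D) ℂ. Assume the PEPS MF symmetries: for every i ∈ ι_A there is a unitary u ∈ Matrix (Fin d) (Fin d) ℂ with u * A = A * (conj(P_i) ⊗ₖ P_{i,1} ⊗ₖ P_{i,2} ⊗ₖ 1), and for every j ∈ ι_B there is a unitary u with u * A = A * (1 ⊗ₖ P̃_{j,1} ⊗ₖ P̃_{j,2} ⊗ₖ conj(P̃_j)). Define the reshuffled matrix T :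 Matrix (Fin d × Fin D × Fin D) (Fin D × Fin D) ℂ by T (k, t, r) (l, b) := A k (l, t, r, b). Then there exists a real number c ≥ 0 with Tᴴ * T = c • 1; i.e., A regarded as a linear map from the (left, bottom) virtual spaces to the (physical, top, right) spaces is a nonnegative multiple of an isometry (the PEPS is isometric). -/
open Matrix Kronecker

/-- The reshuffled tensor. -/
def pepsT {d D : ℕ} (A : Matrix (Fin d) (Fin D × Fin D × Fin D × Fin D) ℂ) :
    Matrix (Fin d × Fin D × Fin D) (Fin D × Fin D) ℂ :=
  Matrix.of fun x y => A x.1 (y.1, x.2.1, x.2.2, y.2)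

lemma peps_left {d D : ℕ} (A : Matrix (Fin d) (Fin D × Fin D × Fin D × Fin D) ℂ)
    (u : Matrix (Fin d) (Fin d) ℂ) :
    pepsT (u * A) = (u ⊗ₖ (1 : Matrix (Fin D × Fin D) (Fin D × Fin D) ℂ)) * pepsT A := by
  ext ⟨k, t, r⟩ ⟨l, b⟩
  simp [pepsT, Matrix.mul_apply, Fintype.sum_prod_type, Matrix.one_apply, Prod.ext_iff, ite_and]

lemma peps_right {d D : ℕ} (A : Matrix (Fin d) (Fin D × Fin D × Fin D × Fin D) ℂ)
    (Q V W R : Matrix (Fin D) (Fin D) ℂ) :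
    pepsT (A * (Q ⊗ₖ (V ⊗ₖ (W ⊗ₖ R)))) =
      ((1 : Matrix (Fin d) (Fin d) ℂ) ⊗ₖ (V ⊗ₖ W)ᵀ) * (pepsT A * (Q ⊗ₖ R)) := by
  ext ⟨k, t, r⟩ ⟨l, b⟩
  simp only [pepsT, Matrix.mul_apply, Fintype.sum_prod_type, Matrix.one_apply, kroneckerMap_apply,
    Matrix.of_apply, Matrix.transpose_apply, ite_mul, one_mul, zero_mul]
  simp only [Finset.mul_sum, Finset.sum_ite_irrel, Finset.sum_const_zero, Finset.sum_ite_eq,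
    Finset.mem_univ, if_true]
  rw [Finset.sum_comm]
  refine Finset.sum_congr rfl fun t' _ => ?_
  rw [Finset.sum_comm]
  refine Finset.sum_congr rfl fun r' _ => ?_
  refine Finset.sum_congr rfl fun l' _ => ?_
  refine Finset.sum_congr rfl fun b' _ => ?_
  ring

lemma peps_commute {d D : ℕ} (A : Matrix (Fin d) (Fin D × Fin D × Fin D × Fin D) ℂ)
    (u : Matrix (Fin d) (Fin d) ℂ) (Q V W R : Matrix (Fin D) (Fin D) ℂ)
    (hu : u ∈ unitaryGroup (Fin d) ℂ) (hQ : Q ∈ unitaryGroup (Fin D) ℂ)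
    (hV : V ∈ unitaryGroup (Fin D) ℂ) (hW : W ∈ unitaryGroup (Fin D) ℂ)
    (hR : R ∈ unitaryGroup (Fin D) ℂ)
    (h : u * A = A * (Q ⊗ₖ (V ⊗ₖ (W ⊗ₖ R)))) :
    Commute (Q ⊗ₖ R) ((pepsT A)ᴴ * pepsT A) := by
  have e := congrArg pepsT h
  rw [peps_left, peps_right] at e
  have hK : (Q ⊗ₖ R) * (Q ⊗ₖ R)ᴴ = 1 := by
    rw [conjTranspose_kronecker, ← mul_kronecker_mul]
    have h1 := mem_unitaryGroup_iff.1 hQ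
    have h2 := mem_unitaryGroup_iff.1 hR
    rw [star_eq_conjTranspose] at h1 h2
    rw [h1, h2, one_kronecker_one]
  have hL : (u ⊗ₖ (1 : Matrix (Fin D × Fin D) (Fin D × Fin D) ℂ))ᴴ * (u ⊗ₖ 1) = 1 := by
    rw [conjTranspose_kronecker, ← mul_kronecker_mul]
    have h1 := mem_unitaryGroup_iff'.1 hu
    rw [star_eq_conjTranspose] at h1
    rw [h1, conjTranspose_one, one_mul, one_kronecker_one]
  have hVW : (V ⊗ₖ W) * (V ⊗ₖ W)ᴴ = 1 := by
    rw [conjTranspose_kronecker, ← mul_kronecker_mul]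
    have h1 := mem_unitaryGroup_iff.1 hV
    have h2 := mem_unitaryGroup_iff.1 hW
    rw [star_eq_conjTranspose] at h1 h2
    rw [h1, h2, one_kronecker_one]
  have hM : ((1 : Matrix (Fin d) (Fin d) ℂ) ⊗ₖ (V ⊗ₖ W)ᵀ)ᴴ * (1 ⊗ₖ (V ⊗ₖ W)ᵀ) = 1 := by
    rw [conjTranspose_kronecker, ← mul_kronecker_mul]
    have : (V ⊗ₖ W)ᵀᴴ * (V ⊗ₖ W)ᵀ = 1 := by
      have := congrArg transpose hVW
      rw [transpose_mul, transpose_one] at this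
      exact this
    rw [this, conjTranspose_one, one_mul, one_kronecker_one]
  generalize (u ⊗ₖ (1 : Matrix (Fin D × Fin D) (Fin D × Fin D) ℂ)) = L at *
  generalize ((1 : Matrix (Fin d) (Fin d) ℂ) ⊗ₖ (V ⊗ₖ W)ᵀ) = M at *
  generalize Q ⊗ₖ R = K at *
  generalize pepsT A = T at *
  have e2 : Tᴴ * T = Kᴴ * (Tᴴ * T) * K := by
    calc Tᴴ * T = Tᴴ * (Lᴴ * L) * T := by rw [hL, Matrix.mul_one]
      _ = (L * T)ᴴ * (L * T) := by simp only [conjTranspose_mul, Matrix.mul_assoc]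
      _ = (M * (T * K))ᴴ * (M * (T * K)) := by rw [e]
      _ = (T * K)ᴴ * (Mᴴ * M) * (T * K) := by
        rw [conjTranspose_mul M]; simp only [Matrix.mul_assoc]
      _ = Kᴴ * (Tᴴ * T) * K := by
        rw [hM, Matrix.mul_one, conjTranspose_mul]; simp only [Matrix.mul_assoc]
  show K * (Tᴴ * T) = (Tᴴ * T) * K
  generalize Tᴴ * T = G at *
  calc K * G = K * (Kᴴ * G * K) := by rw [← e2]
    _ = (K * Kᴴ) * G * K := by simp only [Matrix.mul_assoc]
    _ = G * K := by rw [hK, Matrix.one_mul]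

lemma conj_unitary {D : ℕ} {Q : Matrix (Fin D) (Fin D) ℂ} (h : Q ∈ unitaryGroup (Fin D) ℂ) :
    Q.map (starRingEnd ℂ) ∈ unitaryGroup (Fin D) ℂ := by
  rw [mem_unitaryGroup_iff, star_eq_conjTranspose] at *
  have := congrArg (fun X => X.map (starRingEnd ℂ)) h
  simp only [Matrix.map_mul] at this
  rw [Matrix.map_one _ (map_zero _) (map_one _)] at this
  exact this

lemma span_conj {D : ℕ} {ι : Type*} (P : ι → Matrix (Fin D) (Fin D) ℂ)
    (hs : Submodule.span ℂ (Set.range P) = ⊤)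
    (p : Matrix (Fin D) (Fin D) ℂ → Prop) (h0 : p 0)
    (hadd : ∀ X Y, p X → p Y → p (X + Y)) (hsm : ∀ (a : ℂ) X, p X → p (a • X))
    (hP : ∀ i, p ((P i).map (starRingEnd ℂ))) (X : Matrix (Fin D) (Fin D) ℂ) : p X := by
  have key : ∀ Y ∈ Submodule.span ℂ (Set.range P), p (Y.map (starRingEnd ℂ)) := by
    intro Y hY
    induction hY using Submodule.span_induction with
    | mem x hx => obtain ⟨i, rfl⟩ := hx; exact hP i
    | zero => simpa using h0
    | add x y _ _ hx hy =>
      have := hadd _ _ hx hy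
      rwa [← Matrix.map_add _ (map_add _)] at this
    | smul a x _ hx =>
      have := hsm (starRingEnd ℂ a) _ hx
      convert this using 1
      ext i j; simp
  have := key (X.map (starRingEnd ℂ)) (by rw [hs]; trivial)
  convert this using 1
  ext i j; simp

open ComplexOrder in
lemma diag_re_im {m n : Type*} [Fintype m] [Fintype n] (T : Matrix m n ℂ) (y : n) :
    0 ≤ ((Tᴴ * T) y y).re ∧ 0 = ((Tᴴ * T) y y).im :=
  Complex.nonneg_iff.1 (posSemidef_conjTranspose_mul_self T).diag_nonneg

/-- **MF PEPS are isometric tensor networks.**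
If a PEPS tensor `A` (virtual indices ordered left, top, right, bottom) has the
two PEPS MF symmetries, with the left family `(P i)` and the bottom family
`(P̃ j)` each spanning `Matrix (Fin D) (Fin D) ℂ`, then `A`, reshuffled as a map
from the (left, bottom) virtual spaces to the (physical, top, right) spaces, is
a nonnegative multiple of an isometry. -/
theorem mf_peps_isometric (d D : ℕ) (hd : 1 ≤ d) (hD : 1 ≤ D)
    (ιA ιB : Type*)
    (A : Matrix (Fin d) (Fin D × Fin D × Fin D × Fin D) ℂ)
    (P P₁ P₂ : ιA → Matrix (Fin D) (Fin D) ℂ)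
    (Pt Pt₁ Pt₂ : ιB → Matrix (Fin D) (Fin D) ℂ)
    (hPU : ∀ i, P i ∈ Matrix.unitaryGroup (Fin D) ℂ)
    (hP₁U : ∀ i, P₁ i ∈ Matrix.unitaryGroup (Fin D) ℂ)
    (hP₂U : ∀ i, P₂ i ∈ Matrix.unitaryGroup (Fin D) ℂ)
    (hPtU : ∀ j, Pt j ∈ Matrix.unitaryGroup (Fin D) ℂ)
    (hPt₁U : ∀ j, Pt₁ j ∈ Matrix.unitaryGroup (Fin D) ℂ)
    (hPt₂U : ∀ j, Pt₂ j ∈ Matrix.unitaryGroup (Fin D) ℂ)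
    (hspanA : Submodule.span ℂ (Set.range P) = ⊤)
    (hspanB : Submodule.span ℂ (Set.range Pt) = ⊤)
    (hsymA : ∀ i, ∃ u ∈ Matrix.unitaryGroup (Fin d) ℂ,
      u * A = A * ((P i).map (starRingEnd ℂ) ⊗ₖ
        (P₁ i ⊗ₖ (P₂ i ⊗ₖ (1 : Matrix (Fin D) (Fin D) ℂ)))))
    (hsymB : ∀ j, ∃ u ∈ Matrix.unitaryGroup (Fin d) ℂ,
      u * A = A * ((1 : Matrix (Fin D) (Fin D) ℂ) ⊗ₖ
        (Pt₁ j ⊗ₖ (Pt₂ j ⊗ₖ (Pt j).map (starRingEnd ℂ))))) :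
    ∃ c : ℝ, 0 ≤ c ∧
      (Matrix.of fun (x : Fin d × Fin D × Fin D) (y : Fin D × Fin D) =>
          A x.1 (y.1, x.2.1, x.2.2, y.2))ᴴ *
        (Matrix.of fun (x : Fin d × Fin D × Fin D) (y : Fin D × Fin D) =>
          A x.1 (y.1, x.2.1, x.2.2, y.2))
      = (c : ℂ) • (1 : Matrix (Fin D × Fin D) (Fin D × Fin D) ℂ) := by
  change ∃ c : ℝ, 0 ≤ c ∧ (pepsT A)ᴴ * pepsT A = _
  have hA : ∀ X : Matrix (Fin D) (Fin D) ℂ,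
      Commute (X ⊗ₖ (1 : Matrix (Fin D) (Fin D) ℂ)) ((pepsT A)ᴴ * pepsT A) := by
    apply span_conj P hspanA
    · rw [zero_kronecker]; exact Commute.zero_left _
    · intro X Y hX hY; rw [add_kronecker]; exact hX.add_left hY
    · intro a X hX; rw [smul_kronecker]; exact hX.smul_left a
    · intro i
      obtain ⟨u, hu, h⟩ := hsymA i
      exact peps_commute A u _ _ _ _ hu (conj_unitary (hPU i)) (hP₁U i) (hP₂U i) (one_mem _) h
  have hB : ∀ X : Matrix (Fin D) (Fin D) ℂ,
      Commute ((1 : Matrix (Fin D) (Fin D) ℂ) ⊗ₖ X) ((pepsT A)ᴴ * pepsT A) := by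
    apply span_conj Pt hspanB
    · rw [kronecker_zero]; exact Commute.zero_left _
    · intro X Y hX hY; rw [kronecker_add]; exact hX.add_left hY
    · intro a X hX; rw [kronecker_smul]; exact hX.smul_left a
    · intro j
      obtain ⟨u, hu, h⟩ := hsymB j
      exact peps_commute A u _ _ _ _ hu (one_mem _) (hPt₁U j) (hPt₂U j) (conj_unitary (hPtU j)) h
  have y : Fin D × Fin D := (⟨0, hD⟩, ⟨0, hD⟩)
  have hpos := diag_re_im (pepsT A) y
  generalize (pepsT A)ᴴ * pepsT A = G at *
  obtain ⟨z, hz⟩ : G ∈ Set.range (Matrix.scalar (Fin D × Fin D)) := by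
    apply Matrix.mem_range_scalar_of_commute_single
    rintro ⟨i, k⟩ ⟨j, l⟩ -
    have := (hA (single i j 1)).mul_left (hB (single k l 1))
    rw [← mul_kronecker_mul, Matrix.mul_one, Matrix.one_mul, single_kronecker_single,
      mul_one] at this
    exact this
  have hzz : G y y = z := by rw [← hz]; simp
  rw [hzz] at hpos
  obtain ⟨h2, h3⟩ := hpos
  refine ⟨z.re, h2, ?_⟩
  have : (z.re : ℂ) = z := Complex.ext (by simp) (by simpa using h3)
  rw [this, ← hz, scalar_apply, smul_one_eq_diagonal]
end

section
/- Let D ≥ 1, let G be a finite abelian additive group, and let P : G → Matrix (Fin D) (Fin D) ℂ be a linearly independent family of unitary matrices forming a projective representation: there are scalars c g h ∈ ℂ with P g * P h = (c g h) • P (g + h) for all g, h ∈ G. Fix m ∈ G and φ ∈ ℝ, and assume ((c g m) / (c m g))² = 1 for all g ∈ G. Let α : G → ℂ and set Q := Σ_{g∈G} (α g) • ((P g)ᴴ ⊗ₖ P g ⊗ₖ P g ⊗ₖ (P g)ᴴ). If Q = exp(iφ) • (Q * (P m ⊗ₖ (P m)ᴴ ⊗ₖ (P m)ᴴ ⊗ₖ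 P m)), then α g = exp(iφ) * α (g + m) for every g ∈ G. If moreover α is not identically zero and n := addOrderOf m, then exp(i n φ) = 1. -/
open Matrix Kronecker

/-- **Charge constraint on MF PEPS coefficients.**
Let `P : G → Matrix (Fin D) (Fin D) ℂ` be a linearly independent projective
unitary representation of a finite abelian group `G`, let `m ∈ G`, `φ ∈ ℝ`,
with `((c g m)/(c m g))² = 1` for all `g`.  If
`Q := Σ_g α g • ((P g)ᴴ ⊗ₖ P g ⊗ₖ P g ⊗ₖ (P g)ᴴ)` satisfies
`Q = exp(iφ) • (Q * (P m ⊗ₖ (P m)ᴴ ⊗ₖ (P m)ᴴ ⊗ₖ P m))`, then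
`α g = exp(iφ) * α (g + m)` for all `g`, and if moreover `α ≠ 0` then
`exp(i n φ) = 1` where `n = addOrderOf m`. -/
theorem mf_peps_charge_constraint (D : ℕ) (hD : 1 ≤ D)
    (G : Type*) [AddCommGroup G] [Fintype G]
    (P : G → Matrix (Fin D) (Fin D) ℂ)
    (hPU : ∀ g, P g ∈ Matrix.unitaryGroup (Fin D) ℂ)
    (hli : LinearIndependent ℂ P)
    (c : G → G → ℂ)
    (hproj : ∀ g h, P g * P h = c g h • P (g + h))
    (m : G) (φ : ℝ)
    (hc2 : ∀ g, (c g m / c m g) ^ 2 = 1)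
    (α : G → ℂ)
    (hQ : (∑ g, α g • ((P g)ᴴ ⊗ₖ (P g ⊗ₖ (P g ⊗ₖ (P g)ᴴ))))
      = Complex.exp (φ * Complex.I) •
        ((∑ g, α g • ((P g)ᴴ ⊗ₖ (P g ⊗ₖ (P g ⊗ₖ (P g)ᴴ)))) *
          (P m ⊗ₖ ((P m)ᴴ ⊗ₖ ((P m)ᴴ ⊗ₖ P m))))) :
    (∀ g, α g = Complex.exp (φ * Complex.I) * α (g + m)) ∧
      (α ≠ 0 → Complex.exp ((addOrderOf m : ℂ) * φ * Complex.I) = 1) := by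
  have hne : ∀ g, P g ≠ 0 := fun g => hli.ne_zero g
  have hUl : ∀ g, (P g)ᴴ * P g = 1 := fun g => Matrix.mem_unitaryGroup_iff'.1 (hPU g)
  have hUr : ∀ g, P g * (P g)ᴴ = 1 := fun g => Matrix.mem_unitaryGroup_iff.1 (hPU g)
  -- shifted action
  have hA : ∀ h, (P (h + m))ᴴ * P m = c m h • (P h)ᴴ := by
    intro h
    calc (P (h + m))ᴴ * P m = (P (h + m))ᴴ * (P m * P h) * (P h)ᴴ := by
          rw [Matrix.mul_assoc, Matrix.mul_assoc, hUr, Matrix.mul_one]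
      _ = c m h • (P h)ᴴ := by
          rw [hproj, add_comm m h, Matrix.mul_smul, hUl, Matrix.smul_mul, Matrix.one_mul]
  have hcne : ∀ h, c h m ≠ 0 := by
    intro h h0
    have := hc2 h
    simp [h0] at this
  have hB : ∀ h, P (h + m) * (P m)ᴴ = (c h m)⁻¹ • P h := by
    intro h
    have : P h = c h m • (P (h + m) * (P m)ᴴ) := by
      rw [← Matrix.smul_mul, ← hproj, Matrix.mul_assoc, hUr, Matrix.mul_one]
    rw [eq_inv_smul_iff₀ (hcne h), ← this]
  have hT : ∀ h, ((P (h + m))ᴴ ⊗ₖ (P (h + m) ⊗ₖ (P (h + m) ⊗ₖ (P (h + m))ᴴ))) *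
      (P m ⊗ₖ ((P m)ᴴ ⊗ₖ ((P m)ᴴ ⊗ₖ P m))) = (P h)ᴴ ⊗ₖ (P h ⊗ₖ (P h ⊗ₖ (P h)ᴴ)) := by
    intro h
    rw [← Matrix.mul_kronecker_mul, ← Matrix.mul_kronecker_mul, ← Matrix.mul_kronecker_mul,
      hA, hB]
    simp only [Matrix.smul_kronecker, Matrix.kronecker_smul, smul_smul]
    have h1 : c m h * ((c h m)⁻¹ * ((c h m)⁻¹ * c m h)) = 1 := by
      have h2 : ((c h m / c m h) ^ 2)⁻¹ = 1 := by rw [hc2 h, inv_one]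
      rw [← h2, ← inv_pow, inv_div]
      ring
    convert one_smul ℂ _ using 2
    rw [← h1]; ring
  have hTli : ∀ a : G → ℂ, (∑ g, a g • ((P g)ᴴ ⊗ₖ (P g ⊗ₖ (P g ⊗ₖ (P g)ᴴ)))) = 0 →
      ∀ g, a g = 0 := by
    intro a ha g
    obtain ⟨i, j, hij⟩ : ∃ i j, P g i j ≠ 0 := by
      by_contra! hcon
      exact hne g (Matrix.ext hcon)
    have key : ∑ g', (a g' * (star (P g' i j) * (P g' i j * star (P g' i j)))) • P g' = 0 := by
      ext k l
      have := congrFun (congrFun ha (j, k, i, j)) (i, l, j, i)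
      simp only [Matrix.sum_apply, Matrix.smul_apply, Matrix.kronecker_apply,
        Matrix.conjTranspose_apply, smul_eq_mul, Matrix.zero_apply] at this ⊢
      rw [← this]
      refine Finset.sum_congr rfl fun x _ => ?_
      ring
    have := Fintype.linearIndependent_iff.1 hli _ key g
    simpa [hij] using this
  have hmain : ∀ g, α g = Complex.exp (φ * Complex.I) * α (g + m) := by
    have h1 : (∑ g, α g • ((P g)ᴴ ⊗ₖ (P g ⊗ₖ (P g ⊗ₖ (P g)ᴴ)))) *
          (P m ⊗ₖ ((P m)ᴴ ⊗ₖ ((P m)ᴴ ⊗ₖ P m))) =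
        ∑ g, α (g + m) • ((P g)ᴴ ⊗ₖ (P g ⊗ₖ (P g ⊗ₖ (P g)ᴴ))) := by
      rw [Finset.sum_mul, ← Equiv.sum_comp (Equiv.addRight m)]
      refine Finset.sum_congr rfl fun x _ => ?_
      rw [Equiv.coe_addRight, Matrix.smul_mul, hT]
    rw [h1, Finset.smul_sum, ← sub_eq_zero, ← Finset.sum_sub_distrib] at hQ
    intro g
    refine sub_eq_zero.1 (hTli (fun g => α g - Complex.exp (φ * Complex.I) * α (g + m)) ?_ g)
    rw [← hQ]
    refine Finset.sum_congr rfl fun x _ => ?_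
    rw [sub_smul, smul_smul]
  refine ⟨hmain, fun hα => ?_⟩
  obtain ⟨g, hg⟩ := Function.ne_iff.1 hα
  have hiter : ∀ k : ℕ, α g = Complex.exp (φ * Complex.I) ^ k * α (g + k • m) := by
    intro k
    induction k with
    | zero => simp
    | succ k ih =>
      rw [ih, hmain (g + k • m), succ_nsmul, pow_succ, add_assoc, mul_assoc]
  have h := hiter (addOrderOf m)
  rw [addOrderOf_nsmul_eq_zero, add_zero, ← Complex.exp_nat_mul, ← mul_assoc] at h
  exact (mul_eq_right₀ hg).1 h.symm
end

section
/- Let D ≥ 1, let G be a finite abelian additive group, and let P : G → Matrix (Fin D) (Fin D) ℂ be a family of unitary matrices with P g * P h = (c g h) • P (g + h) for scalars c g h, satisfying ((c g h) / (c h g))² = 1 for all g, h ∈ G. For α : G → ℂ set Q := Σ_{g∈G} (α g) • ((P g)ᴴ ⊗ₖ P g ⊗ₖ P g ⊗ₖ (P g)ᴴ). Then Qᴴ * Q = Σ_{g∈G} (e g) • ((P g)ᴴ ⊗ₖ P g ⊗ₖ P g ⊗ₖ (P g)ᴴ), where e g := Σ_{h∈G} (α h) * conj(α (h − g)). -/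
open Matrix Kronecker

/-- **The transfer matrix of an MF PEPS with topological-type symmetry.**
Let `P : G → Matrix (Fin D) (Fin D) ℂ` be a projective unitary representation
of a finite abelian group `G` with `((c g h)/(c h g))² = 1` for all `g, h`.
For `Q := Σ_g α g • ((P g)ᴴ ⊗ₖ P g ⊗ₖ P g ⊗ₖ (P g)ᴴ)` the single-column
transfer operator is
`Qᴴ * Q = Σ_g e g • ((P g)ᴴ ⊗ₖ P g ⊗ₖ P g ⊗ₖ (P g)ᴴ)` with
`e g = Σ_h α h * conj (α (h − g))`. -/
theorem mf_peps_transfer_matrix (D : ℕ) (hD : 1 ≤ D)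
    (G : Type*) [AddCommGroup G] [Fintype G]
    (P : G → Matrix (Fin D) (Fin D) ℂ)
    (hPU : ∀ g, P g ∈ Matrix.unitaryGroup (Fin D) ℂ)
    (c : G → G → ℂ)
    (hproj : ∀ g h, P g * P h = c g h • P (g + h))
    (hc2 : ∀ g h, (c g h / c h g) ^ 2 = 1)
    (α : G → ℂ) :
    (∑ g, α g • ((P g)ᴴ ⊗ₖ (P g ⊗ₖ (P g ⊗ₖ (P g)ᴴ))))ᴴ *
        (∑ g, α g • ((P g)ᴴ ⊗ₖ (P g ⊗ₖ (P g ⊗ₖ (P g)ᴴ))))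
      = ∑ g, (∑ h, α h * (starRingEnd ℂ) (α (h - g))) •
          ((P g)ᴴ ⊗ₖ (P g ⊗ₖ (P g ⊗ₖ (P g)ᴴ))) := by
  have hU1 : ∀ g, (P g)ᴴ * P g = 1 := fun g => (Matrix.mem_unitaryGroup_iff'.1 (hPU g))
  have hU2 : ∀ g, P g * (P g)ᴴ = 1 := fun g => (Matrix.mem_unitaryGroup_iff.1 (hPU g))
  have hc : ∀ g h, star (c g h) * c g h = 1 := by
    intro g h
    have h1 : (P g * P h)ᴴ * (P g * P h) = 1 := by
      rw [conjTranspose_mul, Matrix.mul_assoc, ← Matrix.mul_assoc _ (P g), hU1, Matrix.one_mul, hU1]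
    rw [hproj, conjTranspose_smul, Matrix.smul_mul, Matrix.mul_smul, hU1, smul_smul] at h1
    have h2 := congrFun (congrFun h1 ⟨0, hD⟩) ⟨0, hD⟩
    simpa using h2
  have hHH : ∀ a b, (P a)ᴴ * (P b)ᴴ = star (c b a) • (P (a + b))ᴴ := by
    intro a b
    rw [← conjTranspose_mul, hproj, conjTranspose_smul, add_comm]
  obtain ⟨T, hT⟩ : ∃ T : G → _, T = fun g => ((P g)ᴴ ⊗ₖ (P g ⊗ₖ (P g ⊗ₖ (P g)ᴴ))) := ⟨_, rfl⟩
  have hTg : ∀ g, ((P g)ᴴ ⊗ₖ (P g ⊗ₖ (P g ⊗ₖ (P g)ᴴ))) = T g := fun g => by rw [hT]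
  have hTU : ∀ g, (T g)ᴴ * T g = 1 := by
    intro g
    simp only [hT, conjTranspose_kronecker, conjTranspose_conjTranspose, ← mul_kronecker_mul,
      hU1, hU2, one_kronecker_one]
  have hTT : ∀ a b, T a * T b = T (a + b) := by
    intro a b
    simp only [hT, ← mul_kronecker_mul, hHH, hproj, smul_kronecker, kronecker_smul, smul_smul]
    have h1 := hc b a
    have h0 : c b a ≠ 0 := fun h => by simp [h] at h1
    have h2 := hc2 a b
    have h3 : star (c b a) = (c b a)⁻¹ := eq_inv_of_mul_eq_one_left h1
    rw [h3]
    convert one_smul ℂ _ using 2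
    rw [← h2]
    field_simp
  have key : ∀ a b, (T a)ᴴ * T b = T (b - a) := by
    intro a b
    have : T b = T a * T (b - a) := by rw [hTT]; congr 1; abel
    rw [this, ← Matrix.mul_assoc, hTU, Matrix.one_mul]
  simp only [hTg]
  simp only [conjTranspose_sum, conjTranspose_smul, Finset.sum_mul, Finset.mul_sum,
    Matrix.smul_mul, Matrix.mul_smul, key, smul_smul, Finset.sum_smul]
  conv_rhs => rw [Finset.sum_comm]
  refine Finset.sum_congr rfl fun h _ => ?_
  refine Fintype.sum_equiv (Equiv.subLeft h) _ _ fun x => ?_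
  simp [mul_comm]
end

section
/- Let d, D ≥ 1, let (P_i)_{i∈ι} be a family of unitary D×D complex matrices spanning Matrix (Fin D) (Fin D) ℂ, let (P'_i)_{i∈ι} be unitary D×D matrices, and let (u_i)_{i∈ι} be unitary d×d matrices. Let V : Fin d → Matrix (Fin d × Fin D) (Fin D) ℂ be a family of linear maps ℂ^D → ℂ^d ⊗ ℂ^D satisfying: (symmetry) for every i ∈ ι and every a : Fin d, (V a) * P_i = ((u_i)ᴴ ⊗ₖ P'_i) * (V a); and (normalization) trace((V b)ᴴ * (V a)) = D * (if a = b then 1 else 0) for all a, b : Fin d. Then (V b)ᴴ * (V a) = (if a = b then 1 else 0) • (1 : Matrix (Fin D) (Fin D) ℂ) for all a, b; in particular each V a is an isometry and distinct V a, V b have orthogonal ranges. -/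
open Matrix Kronecker

/-- **MF MPO slices are orthogonal isometries.**
Let `(V a)` be the slices of an MPO tensor, each a map `ℂ^D → ℂ^d ⊗ ℂ^D`,
satisfying the MF symmetry `(V a) * P i = ((u i)ᴴ ⊗ₖ P' i) * (V a)` for a
spanning family of unitaries `(P i)`, and the normalization
`trace ((V b)ᴴ * (V a)) = D * δ_{ab}`.  Then
`(V b)ᴴ * (V a) = δ_{ab} • 1`: each `V a` is an isometry and distinct slices
have orthogonal ranges. -/
theorem mf_mpo_orthogonal_isometries (d D : ℕ) (hd : 1 ≤ d) (hD : 1 ≤ D)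
    (ι : Type*)
    (P P' : ι → Matrix (Fin D) (Fin D) ℂ)
    (hPU : ∀ i, P i ∈ Matrix.unitaryGroup (Fin D) ℂ)
    (hP'U : ∀ i, P' i ∈ Matrix.unitaryGroup (Fin D) ℂ)
    (hspan : Submodule.span ℂ (Set.range P) = ⊤)
    (u : ι → Matrix (Fin d) (Fin d) ℂ)
    (hu : ∀ i, u i ∈ Matrix.unitaryGroup (Fin d) ℂ)
    (V : Fin d → Matrix (Fin d × Fin D) (Fin D) ℂ)
    (hsym : ∀ i a, V a * P i = ((u i)ᴴ ⊗ₖ P' i) * V a)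
    (hnorm : ∀ a b, ((V b)ᴴ * V a).trace
      = (D : ℂ) * (if a = b then 1 else 0)) :
    ∀ a b, (V b)ᴴ * V a
      = (if a = b then (1 : ℂ) else 0) • (1 : Matrix (Fin D) (Fin D) ℂ) := by
  intro a b
  have hcomm : ∀ i, (V b)ᴴ * V a * P i = P i * ((V b)ᴴ * V a) := by
    intro i
    have hW : ((u i)ᴴ ⊗ₖ P' i)ᴴ * ((u i)ᴴ ⊗ₖ P' i) = 1 := by
      have h1 : u i * (u i)ᴴ = 1 := Matrix.mem_unitaryGroup_iff.1 (hu i)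
      have h2 : (P' i)ᴴ * P' i = 1 := Matrix.mem_unitaryGroup_iff'.1 (hP'U i)
      rw [Matrix.conjTranspose_kronecker, ← Matrix.mul_kronecker_mul,
        Matrix.conjTranspose_conjTranspose, h1, h2, Matrix.one_kronecker_one]
    have hP : P i * (P i)ᴴ = 1 := Matrix.mem_unitaryGroup_iff.1 (hPU i)
    have key : (P i)ᴴ * ((V b)ᴴ * V a * P i) = (V b)ᴴ * V a := by
      calc (P i)ᴴ * ((V b)ᴴ * V a * P i) = (V b * P i)ᴴ * (V a * P i) := by
            rw [Matrix.conjTranspose_mul]; simp only [Matrix.mul_assoc]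
        _ = (V b)ᴴ * ((((u i)ᴴ ⊗ₖ P' i)ᴴ * ((u i)ᴴ ⊗ₖ P' i)) * V a) := by
            rw [hsym, hsym, Matrix.conjTranspose_mul]; simp only [Matrix.mul_assoc]
        _ = (V b)ᴴ * V a := by rw [hW, Matrix.one_mul]
    calc (V b)ᴴ * V a * P i = P i * (P i)ᴴ * ((V b)ᴴ * V a * P i) := by
          rw [hP, Matrix.one_mul]
      _ = P i * ((V b)ᴴ * V a) := by rw [Matrix.mul_assoc, key]
  have hn := hnorm a b
  generalize (V b)ᴴ * V a = M at hcomm hn ⊢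
  have hall : ∀ X, M * X = X * M := by
    intro X
    have hX : X ∈ Submodule.span ℂ (Set.range P) := by rw [hspan]; trivial
    induction hX using Submodule.span_induction with
    | mem x hx => obtain ⟨i, rfl⟩ := hx; exact hcomm i
    | zero => simp
    | add x y _ _ hx hy => rw [mul_add, add_mul, hx, hy]
    | smul c x _ hx => rw [Matrix.mul_smul, Matrix.smul_mul, hx]
  obtain ⟨c, rfl⟩ := Matrix.mem_range_scalar_of_commute_single
    (M := M) (fun i j _ => (hall _).symm)
  have hD0 : (D : ℂ) ≠ 0 := by exact_mod_cast (by omega : D ≠ 0)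
  have hc : c = if a = b then 1 else 0 := by
    apply mul_left_cancel₀ hD0
    rw [← hn]
    simp [Matrix.trace]
  rw [← hc]
  ext i j
  simp [Matrix.diagonal_apply, Matrix.one_apply]
end

section
/- Let d, D ≥ 1, let (P_i)_{i∈ι} be a family of unitary D×D complex matrices spanning Matrix (Fin D) (Fin D) ℂ, let (P'_i)_{i∈ι} be unitary D×D matrices, and let (u_i)_{i∈ι} be unitary d×d matrices. Let V, V' : Fin d → Matrix (Fin d × Fin D) (Fin D) ℂ be two families satisfying, for all i ∈ ι and a, b : Fin d: (V a) * P_i = ((u_i)ᴴ ⊗ₖ P'_i) * (V a), (V' a) * P_i = ((u_i)ᴴ ⊗ₖ P'_i) * (V' a) (the same symmetry data for both), (V b)ᴴ * (V a) = (if a = b then 1 else 0) • 1, and (V' b)ᴴ * (V' a) = (if a = b then 1 else 0) • 1. Define U, U' ∈ Matrix (Fin d × Fin D) (Fin d × Fin D) ℂ by U (k, a') (a, b) := (V a) (k, a') b and U' (k, a') (a, b) := (V' a) (k, a') b. Then: (1) U and U' are unitary; (2) U * (1 ⊗ₖ P_i) = ((u_i)ᴴ ⊗ₖ P'_i) * U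 for every i ∈ ι, and likewise for U'; (3) there exists a unitary Ũ ∈ Matrix (Fin d) (Fin d) ℂ with U' = U * (Ũ ⊗ₖ 1). Hence any two MPO tensors implementable by measurement and feedback with the same symmetry data differ only by a local unitary rotation on the physical input leg. -/
open Matrix Kronecker

theorem aux_unitary {d D : ℕ} (V : Fin d → Matrix (Fin d × Fin D) (Fin D) ℂ)
    (hortho : ∀ a b, (V b)ᴴ * V a
      = (if a = b then (1 : ℂ) else 0) • (1 : Matrix (Fin D) (Fin D) ℂ))
    (U : Matrix (Fin d × Fin D) (Fin d × Fin D) ℂ)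
    (hU : ∀ (p : Fin d × Fin D) (q : Fin d × Fin D), U p q = V q.1 p q.2) :
    U ∈ Matrix.unitaryGroup (Fin d × Fin D) ℂ := by
  rw [Matrix.mem_unitaryGroup_iff', Matrix.star_eq_conjTranspose]
  ext ⟨b, j⟩ ⟨a, i⟩
  have h := congrFun (congrFun (hortho a b) j) i
  simp only [Matrix.mul_apply, Matrix.conjTranspose_apply, hU] at h ⊢
  rw [h]
  by_cases hab : a = b
  · subst hab
    simp [Matrix.one_apply]
  · simp [Matrix.one_apply, hab, Ne.symm hab]

theorem aux_inter {d D : ℕ} (V : Fin d → Matrix (Fin d × Fin D) (Fin D) ℂ)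
    (P : Matrix (Fin D) (Fin D) ℂ) (G : Matrix (Fin d × Fin D) (Fin d × Fin D) ℂ)
    (hsym : ∀ a, V a * P = G * V a)
    (U : Matrix (Fin d × Fin D) (Fin d × Fin D) ℂ)
    (hU : ∀ (p : Fin d × Fin D) (q : Fin d × Fin D), U p q = V q.1 p q.2) :
    U * ((1 : Matrix (Fin d) (Fin d) ℂ) ⊗ₖ P) = G * U := by
  ext p ⟨a, i⟩
  have h := congrFun (congrFun (hsym a) p) i
  simp only [Matrix.mul_apply, hU] at h ⊢
  rw [← h, Fintype.sum_prod_type, Finset.sum_eq_single a]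
  · simp [Matrix.kroneckerMap_apply]
  · intro b _ hb
    simp [Matrix.kroneckerMap_apply, Matrix.one_apply, hb]
  · simp

theorem aux_comm {d D : ℕ} (z : Fin D) (W : Matrix (Fin d × Fin D) (Fin d × Fin D) ℂ)
    (h : ∀ X : Matrix (Fin D) (Fin D) ℂ, W * ((1 : Matrix (Fin d) (Fin d) ℂ) ⊗ₖ X)
      = ((1 : Matrix (Fin d) (Fin d) ℂ) ⊗ₖ X) * W) :
    W = (Matrix.of fun a b => W (a, z) (b, z)) ⊗ₖ (1 : Matrix (Fin D) (Fin D) ℂ) := by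
  ext ⟨a, i⟩ ⟨b, j⟩
  have h := congrFun (congrFun (h (Matrix.single j z 1)) (a, i)) (b, z)
  simp only [Matrix.mul_apply, Fintype.sum_prod_type, Matrix.kroneckerMap_apply,
    Matrix.one_apply, Matrix.single_apply] at h
  rw [Finset.sum_eq_single b (by intro c _ hc; simp [hc]) (by simp),
    Finset.sum_eq_single j (by intro c _ hc; simp [Ne.symm hc]) (by simp),
    Finset.sum_eq_single a (by intro c _ hc; simp [Ne.symm hc]) (by simp),
    Finset.sum_eq_single z (by intro c _ hc; simp [Ne.symm hc]) (by simp)] at h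
  simp only [Matrix.kroneckerMap_apply, Matrix.of_apply, Matrix.one_apply]
  by_cases hij : i = j
  · subst hij
    simpa using h
  · simpa [hij, Ne.symm hij] using h

/-- **MF MPOs with the same symmetry data differ by a local unitary.**
Let `V, V'` be two families of orthogonal-isometry MPO slices with the same MF
symmetry data `(P i, P' i, u i)`, and assemble them into the block matrices
`U (k, a') (a, b) = (V a) (k, a') b` and similarly for `U'`.  Then `U, U'` are
unitary, they intertwine `1 ⊗ₖ P i` with `(u i)ᴴ ⊗ₖ P' i`, and
`U' = U * (Ũ ⊗ₖ 1)` for some unitary `Ũ` acting only on the physical input. -/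
theorem mf_mpo_unique_up_to_local_unitary (d D : ℕ) (hd : 1 ≤ d) (hD : 1 ≤ D)
    (ι : Type*)
    (P P' : ι → Matrix (Fin D) (Fin D) ℂ)
    (hPU : ∀ i, P i ∈ Matrix.unitaryGroup (Fin D) ℂ)
    (hP'U : ∀ i, P' i ∈ Matrix.unitaryGroup (Fin D) ℂ)
    (hspan : Submodule.span ℂ (Set.range P) = ⊤)
    (u : ι → Matrix (Fin d) (Fin d) ℂ)
    (hu : ∀ i, u i ∈ Matrix.unitaryGroup (Fin d) ℂ)
    (V V' : Fin d → Matrix (Fin d × Fin D) (Fin D) ℂ)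
    (hsym : ∀ i a, V a * P i = ((u i)ᴴ ⊗ₖ P' i) * V a)
    (hsym' : ∀ i a, V' a * P i = ((u i)ᴴ ⊗ₖ P' i) * V' a)
    (hortho : ∀ a b, (V b)ᴴ * V a
      = (if a = b then (1 : ℂ) else 0) • (1 : Matrix (Fin D) (Fin D) ℂ))
    (hortho' : ∀ a b, (V' b)ᴴ * V' a
      = (if a = b then (1 : ℂ) else 0) • (1 : Matrix (Fin D) (Fin D) ℂ))
    (U U' : Matrix (Fin d × Fin D) (Fin d × Fin D) ℂ)
    (hU : ∀ (p : Fin d × Fin D) (q : Fin d × Fin D), U p q = V q.1 p q.2)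
    (hU' : ∀ (p : Fin d × Fin D) (q : Fin d × Fin D), U' p q = V' q.1 p q.2) :
    (U ∈ Matrix.unitaryGroup (Fin d × Fin D) ℂ ∧
      U' ∈ Matrix.unitaryGroup (Fin d × Fin D) ℂ) ∧
    (∀ i, U * ((1 : Matrix (Fin d) (Fin d) ℂ) ⊗ₖ P i) = ((u i)ᴴ ⊗ₖ P' i) * U ∧
      U' * ((1 : Matrix (Fin d) (Fin d) ℂ) ⊗ₖ P i) = ((u i)ᴴ ⊗ₖ P' i) * U') ∧
    (∃ Ut ∈ Matrix.unitaryGroup (Fin d) ℂ,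
      U' = U * (Ut ⊗ₖ (1 : Matrix (Fin D) (Fin D) ℂ))) := by
  have uU := aux_unitary V hortho U hU
  have uU' := aux_unitary V' hortho' U' hU'
  have iU := fun i => aux_inter V (P i) _ (hsym i) U hU
  have iU' := fun i => aux_inter V' (P i) _ (hsym' i) U' hU'
  refine ⟨⟨uU, uU'⟩, fun i => ⟨iU i, iU' i⟩, ?_⟩
  have e1 := Matrix.mem_unitaryGroup_iff.1 uU
  have e2 := Matrix.mem_unitaryGroup_iff'.1 uU
  let z : Fin D := ⟨0, hD⟩
  have hW : ∀ X : Matrix (Fin D) (Fin D) ℂ,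
      (star U * U') * ((1 : Matrix (Fin d) (Fin d) ℂ) ⊗ₖ X)
      = ((1 : Matrix (Fin d) (Fin d) ℂ) ⊗ₖ X) * (star U * U') := by
    intro X
    have hX : X ∈ Submodule.span ℂ (Set.range P) := by rw [hspan]; trivial
    induction hX using Submodule.span_induction with
    | mem x hx =>
      obtain ⟨i, rfl⟩ := hx
      have key : star U * ((u i)ᴴ ⊗ₖ P' i)
          = ((1 : Matrix (Fin d) (Fin d) ℂ) ⊗ₖ P i) * star U := by
        calc star U * ((u i)ᴴ ⊗ₖ P' i)
            = star U * (((u i)ᴴ ⊗ₖ P' i) * (U * star U)) := by rw [e1, mul_one]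
          _ = star U * ((((u i)ᴴ ⊗ₖ P' i) * U) * star U) := by simp only [mul_assoc]
          _ = (star U * U) * ((1 : Matrix (Fin d) (Fin d) ℂ) ⊗ₖ P i) * star U := by
            rw [← iU i]; simp only [mul_assoc]
          _ = _ := by rw [e2, one_mul]
      rw [mul_assoc, iU' i, ← mul_assoc, key, mul_assoc]
    | zero => simp
    | add x y _ _ hx hy => rw [Matrix.kronecker_add, mul_add, add_mul, hx, hy]
    | smul c x _ hx =>
      rw [Matrix.kronecker_smul, Matrix.mul_smul, Matrix.smul_mul, hx]
  obtain ⟨T, hK⟩ : ∃ T : Matrix (Fin d) (Fin d) ℂ,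
      star U * U' = T ⊗ₖ (1 : Matrix (Fin D) (Fin D) ℂ) := ⟨_, aux_comm z (star U * U') hW⟩
  have uW : star U * U' ∈ Matrix.unitaryGroup (Fin d × Fin D) ℂ :=
    mul_mem (Unitary.star_mem uU) uU'
  refine ⟨T, ?_, ?_⟩
  rotate_left
  · rw [← hK, ← mul_assoc, e1, one_mul]
  · have h2 := Matrix.mem_unitaryGroup_iff'.1 uW
    rw [hK] at h2
    rw [Matrix.mem_unitaryGroup_iff']
    rw [Matrix.star_eq_conjTranspose, Matrix.conjTranspose_kronecker,
      Matrix.conjTranspose_one, ← Matrix.mul_kronecker_mul, mul_one] at h2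
    ext a b
    have h3 := congrFun (congrFun h2 (a, z)) (b, z)
    simpa [Matrix.kroneckerMap_apply, Matrix.one_apply, Matrix.star_eq_conjTranspose] using h3
end

section
/- Let d, D ≥ 1, let A : Matrix (Fin d) (Fin D × Fin D) ℂ, and let (P_i)_{i∈ι}, (P'_i)_{i∈ι} be families of unitary D×D matrices such that (P_i)_{i∈ι} spans Matrix (Fin D) (Fin D) ℂ and for every i there exists a unitary u ∈ Matrix (Fin d) (Fin d) ℂ with u * A = A * (conj(P_i) ⊗ₖ P'_i). Let Q be the positive semidefinite square root of Aᴴ * A, and define the sideways reshuffle V_Q : Matrix (Fin D × Fin D × Fin D) (Fin D) ℂ by V_Q (a', b', b) a := Q (a', b') (a, b). Then there exists a real number c ≥ 0 with (V_Q)ᴴ * V_Q = c • 1; i.e., Q read sideways is a nonnegative multiple of an isometry from ℂ^D to ℂ^{D³}. -/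
open Matrix Kronecker ComplexOrder

/-- partial trace over the second factor -/
def ptr2 {D : ℕ} (M : Matrix (Fin D × Fin D) (Fin D × Fin D) ℂ) : Matrix (Fin D) (Fin D) ℂ :=
  Matrix.of fun a a' => ∑ b, M (a, b) (a', b)

lemma ptr2_mul_right {D : ℕ} (M : Matrix (Fin D × Fin D) (Fin D × Fin D) ℂ)
    (C : Matrix (Fin D) (Fin D) ℂ) : ptr2 (M * (C ⊗ₖ 1)) = ptr2 M * C := by
  ext a a'
  simp only [ptr2, Matrix.of_apply, Matrix.mul_apply, Fintype.sum_prod_type,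
    Matrix.kroneckerMap_apply, Matrix.one_apply, mul_ite, mul_one, mul_zero,
    Finset.sum_ite_eq', Finset.mem_univ, if_true, Finset.sum_mul]
  rw [Finset.sum_comm]

lemma ptr2_mul_left {D : ℕ} (M : Matrix (Fin D × Fin D) (Fin D × Fin D) ℂ)
    (C : Matrix (Fin D) (Fin D) ℂ) : ptr2 ((C ⊗ₖ 1) * M) = C * ptr2 M := by
  ext a a'
  simp only [ptr2, Matrix.of_apply, Matrix.mul_apply, Fintype.sum_prod_type,
    Matrix.kroneckerMap_apply, Matrix.one_apply, mul_ite, ite_mul, zero_mul, mul_one, mul_zero,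
    Finset.sum_ite_eq, Finset.mem_univ, if_true, Finset.mul_sum]
  rw [Finset.sum_comm]

lemma ptr2_cyc {D : ℕ} (M : Matrix (Fin D × Fin D) (Fin D × Fin D) ℂ)
    (U : Matrix (Fin D) (Fin D) ℂ) : ptr2 (((1 : Matrix (Fin D) (Fin D) ℂ) ⊗ₖ U) * M) = ptr2 (M * ((1 : Matrix (Fin D) (Fin D) ℂ) ⊗ₖ U)) := by
  ext a a'
  simp only [ptr2, Matrix.of_apply, Matrix.mul_apply, Fintype.sum_prod_type_right,
    Matrix.kroneckerMap_apply, Matrix.one_apply, mul_ite, ite_mul, zero_mul, one_mul, mul_zero,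
    Finset.sum_ite_eq, Finset.sum_ite_eq', Finset.mem_univ, if_true]
  rw [Finset.sum_comm]
  simp only [mul_comm]

/-- **`Q` read sideways is proportional to an isometry.**
Let `A` be an MPS tensor with the MF symmetry for a spanning family of
unitaries `(P i)` (with partners `(P' i)`), and let `Q` be the positive
semidefinite square root of `Aᴴ * A`.  Then the sideways reshuffle
`V_Q (a', b', b) a := Q (a', b') (a, b)` satisfies `(V_Q)ᴴ * V_Q = c • 1`
for some `c ≥ 0`, i.e. it is a nonnegative multiple of an isometry
`ℂ^D → ℂ^{D³}`. -/
theorem mf_mps_sqrt_sideways_isometry (d D : ℕ) (hd : 1 ≤ d) (hD : 1 ≤ D)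
    (ι : Type*)
    (A : Matrix (Fin d) (Fin D × Fin D) ℂ)
    (P P' : ι → Matrix (Fin D) (Fin D) ℂ)
    (hPU : ∀ i, P i ∈ Matrix.unitaryGroup (Fin D) ℂ)
    (hP'U : ∀ i, P' i ∈ Matrix.unitaryGroup (Fin D) ℂ)
    (hspan : Submodule.span ℂ (Set.range P) = ⊤)
    (hsym : ∀ i, ∃ u ∈ Matrix.unitaryGroup (Fin d) ℂ,
      u * A = A * ((P i).map (starRingEnd ℂ) ⊗ₖ P' i))
    (Q : Matrix (Fin D × Fin D) (Fin D × Fin D) ℂ)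
    (hQpsd : Q.PosSemidef) (hQsq : Q * Q = Aᴴ * A) :
    ∃ c : ℝ, 0 ≤ c ∧
      (Matrix.of fun (x : Fin D × Fin D × Fin D) (a : Fin D) =>
          Q (x.1, x.2.1) (a, x.2.2))ᴴ *
        (Matrix.of fun (x : Fin D × Fin D × Fin D) (a : Fin D) =>
          Q (x.1, x.2.1) (a, x.2.2))
      = (c : ℂ) • (1 : Matrix (Fin D) (Fin D) ℂ) := by
  set V : Matrix (Fin D × Fin D × Fin D) (Fin D) ℂ :=
    Matrix.of fun (x : Fin D × Fin D × Fin D) (a : Fin D) => Q (x.1, x.2.1) (a, x.2.2) with hV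
  have hT : Vᴴ * V = ptr2 (Aᴴ * A) := by
    rw [← hQsq]
    nth_rewrite 1 [← hQpsd.isHermitian.eq]
    ext a a'
    simp only [hV, ptr2, Matrix.of_apply, Matrix.mul_apply, Fintype.sum_prod_type,
      Matrix.conjTranspose_apply]
    conv_rhs => rw [Finset.sum_comm]
    refine Finset.sum_congr rfl fun x _ => ?_
    rw [Finset.sum_comm]
  have hcomm : ∀ i, ptr2 (Aᴴ * A) * (P i).map (starRingEnd ℂ)
      = (P i).map (starRingEnd ℂ) * ptr2 (Aᴴ * A) := by
    intro i
    obtain ⟨u, hu, h⟩ := hsym i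
    set C := (P i).map (starRingEnd ℂ) with hC
    have hCU : C * Cᴴ = 1 := by
      have h1 := Matrix.mem_unitaryGroup_iff.1 (hPU i)
      have h2 := congrArg (fun X => X.map (starRingEnd ℂ)) h1
      simp only [Matrix.map_mul] at h2
      rw [Matrix.map_one _ (map_zero _) (map_one _)] at h2
      exact h2
    have hP1 : P' i * (P' i)ᴴ = 1 := Matrix.mem_unitaryGroup_iff.1 (hP'U i)
    have hP2 : (P' i)ᴴ * P' i = 1 := Matrix.mem_unitaryGroup_iff'.1 (hP'U i)
    have hu' : uᴴ * u = 1 := Matrix.mem_unitaryGroup_iff'.1 hu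
    have e1 : Aᴴ * A = (C ⊗ₖ P' i)ᴴ * (Aᴴ * A) * (C ⊗ₖ P' i) := by
      have h3 : (u * A)ᴴ * (u * A) = Aᴴ * A := by
        rw [Matrix.conjTranspose_mul, Matrix.mul_assoc, ← Matrix.mul_assoc uᴴ, hu', Matrix.one_mul]
      rw [← h3, h, Matrix.conjTranspose_mul]
      have h4 : (A * (C ⊗ₖ P' i))ᴴ * (A * (C ⊗ₖ P' i)) = Aᴴ * A := by rw [← h, h3]
      rw [Matrix.conjTranspose_mul] at h4
      rw [h4]
      simpa only [Matrix.mul_assoc] using h4.symm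
    have hWU : (C ⊗ₖ P' i) * (C ⊗ₖ P' i)ᴴ = 1 := by
      rw [Matrix.conjTranspose_kronecker, ← Matrix.mul_kronecker_mul, hCU, hP1,
        Matrix.one_kronecker_one]
    have e2 : (C ⊗ₖ P' i) * (Aᴴ * A) = (Aᴴ * A) * (C ⊗ₖ P' i) := by
      conv_lhs => rw [e1]
      rw [← Matrix.mul_assoc, ← Matrix.mul_assoc, hWU, Matrix.one_mul]
    generalize Aᴴ * A = M at e2
    have e3 : C ⊗ₖ P' i = (C ⊗ₖ (1 : Matrix (Fin D) (Fin D) ℂ)) * ((1 : Matrix (Fin D) (Fin D) ℂ) ⊗ₖ P' i) := by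
      rw [← Matrix.mul_kronecker_mul, Matrix.mul_one, Matrix.one_mul]
    have hB : ((1 : Matrix (Fin D) (Fin D) ℂ) ⊗ₖ P' i) * ((1 : Matrix (Fin D) (Fin D) ℂ) ⊗ₖ (P' i)ᴴ) = 1 := by
      rw [← Matrix.mul_kronecker_mul, hP1, Matrix.one_mul, Matrix.one_kronecker_one]
    have hB2 : ((1 : Matrix (Fin D) (Fin D) ℂ) ⊗ₖ (P' i)ᴴ) * ((1 : Matrix (Fin D) (Fin D) ℂ) ⊗ₖ (P' i)) = 1 := by
      rw [← Matrix.mul_kronecker_mul, hP2, Matrix.one_mul, Matrix.one_kronecker_one]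
    rw [e3] at e2
    have e4 : M * (C ⊗ₖ (1 : Matrix (Fin D) (Fin D) ℂ)) = (C ⊗ₖ (1 : Matrix (Fin D) (Fin D) ℂ)) *
        (((1 : Matrix (Fin D) (Fin D) ℂ) ⊗ₖ P' i) * (M * ((1 : Matrix (Fin D) (Fin D) ℂ) ⊗ₖ (P' i)ᴴ))) := by
      have := congrArg (fun X => X * ((1 : Matrix (Fin D) (Fin D) ℂ) ⊗ₖ (P' i)ᴴ)) e2
      simp only [Matrix.mul_assoc] at this
      rw [hB, Matrix.mul_one] at this
      exact this.symm
    rw [← ptr2_mul_right, e4, ptr2_mul_left, ptr2_cyc, Matrix.mul_assoc, hB2, Matrix.mul_one]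
  rw [hT]
  have hcomm' : ∀ X : Matrix (Fin D) (Fin D) ℂ, Commute X ((ptr2 (Aᴴ * A)).map (starRingEnd ℂ)) := by
    intro X
    have hX : X ∈ Submodule.span ℂ (Set.range P) := by rw [hspan]; trivial
    induction hX using Submodule.span_induction with
    | mem x h =>
      obtain ⟨i, rfl⟩ := h
      have := congrArg (fun X => X.map (starRingEnd ℂ)) (hcomm i)
      simp only [Matrix.map_mul, Matrix.map_map] at this
      have h2 : (P i).map ((starRingEnd ℂ) ∘ (starRingEnd ℂ)) = P i := by
        ext; simp
      rw [h2] at this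
      exact this.symm
    | zero => exact Commute.zero_left _
    | add x y _ _ hx hy => exact hx.add_left hy
    | smul a x _ hx => exact hx.smul_left a
  obtain ⟨z, hz⟩ := Matrix.mem_range_scalar_of_commute_single (fun i j _ => hcomm' _)
  have hz' : ptr2 (Aᴴ * A) = (starRingEnd ℂ z) • (1 : Matrix (Fin D) (Fin D) ℂ) := by
    ext a b
    have := congrArg (starRingEnd ℂ) (congrFun (congrFun hz a) b)
    simp only [Matrix.map_apply, Complex.conj_conj] at this
    rw [← this]
    by_cases hab : a = b <;> simp [hab]
  have hpos : (0 : ℂ) ≤ starRingEnd ℂ z := by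
    have := (Matrix.posSemidef_conjTranspose_mul_self V).diag_nonneg (i := ⟨0, hD⟩)
    rw [hT, hz'] at this
    simpa using this
  obtain ⟨hre, him⟩ := Complex.le_def.1 hpos
  refine ⟨(starRingEnd ℂ z).re, by simpa using hre, ?_⟩
  rw [hz']
  congr 1
  apply Complex.ext
  · simp
  · simpa using him.symm
end
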